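/- arXiv:1612.05205 — 2 statements merged into one kernel-verified Lean document; each statement's English description precedes it below -/
import Mathlib

section
/- Consider a finite set of events, each assigned an HLC timestamp, together with an edge relation consisting of (i) process-order edges from each event to the next event of the same process and (ii) message edges from each send event to its matching receive event. Suppose that along every edge (e, f) the HLC timestamp of f is computed from the HLC timestamp of the predecessor(s) of f by the HLC update rules (send/local-event update for local events and sends, receive-update for receives, using the sender's timestamp as the message timestamp). Let happens-before be the transitive closure of the edge relation. Then for all events e and f, if e happens-before f, then the HLC timestamp of e is strictly less than the HLC timestamp of f in the lexicographic order. -/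
/-- Lexicographic strict order on HLC timestamps, i.e. pairs `(l, c)` of naturals:
`(l₁, c₁) < (l₂, c₂)` iff `l₁ < l₂`, or `l₁ = l₂` and `c₁ < c₂`. -/
def hlcLt (a b : ℕ × ℕ) : Prop :=
  a.1 < b.1 ∨ (a.1 = b.1 ∧ a.2 < b.2)

/-- The HLC send/local-event update on a current timestamp `cur` with physical clock
value `pt`: the new `l` is `max(cur.l, pt)`, and `c = cur.c + 1` if `l = cur.l`,
`c = 0` otherwise. -/
def hlcSend (cur : ℕ × ℕ) (pt : ℕ) : ℕ × ℕ :=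
  let l := max cur.1 pt
  if l = cur.1 then (l, cur.2 + 1) else (l, 0)

/-- The HLC receive-update on a current timestamp `cur` with physical clock value `pt`
and message timestamp `m`: the new `l` is `max(cur.l, m.l, pt)`, with the counter
defined by cases as in the HLC algorithm. -/
def hlcRecv (cur : ℕ × ℕ) (pt : ℕ) (m : ℕ × ℕ) : ℕ × ℕ :=
  let l := max cur.1 (max m.1 pt)
  if l = cur.1 ∧ l = m.1 then (l, max cur.2 m.2 + 1)
  else if l = cur.1 then (l, cur.2 + 1)
  else if l = m.1 then (l, m.2 + 1)
  else (l, 0)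

theorem hlcLt_send (a : ℕ × ℕ) (pt : ℕ) : hlcLt a (hlcSend a pt) := by
  unfold hlcLt hlcSend
  dsimp only
  split_ifs <;> dsimp only <;> omega

theorem hlcLt_recv_cur (a : ℕ × ℕ) (pt : ℕ) (m : ℕ × ℕ) : hlcLt a (hlcRecv a pt m) := by
  unfold hlcLt hlcRecv
  dsimp only
  split_ifs <;> dsimp only <;> omega

theorem hlcLt_recv_msg (a : ℕ × ℕ) (pt : ℕ) (m : ℕ × ℕ) : hlcLt m (hlcRecv a pt m) := by
  unfold hlcLt hlcRecv
  dsimp only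
  split_ifs <;> dsimp only <;> omega

theorem hlcLt_trans' {a b c : ℕ × ℕ} (h : hlcLt a b) (k : hlcLt b c) : hlcLt a c := by
  unfold hlcLt at *
  omega

/-- Consider a finite set `E` of events with HLC timestamps `hlc`, a process-order
edge relation `proc` (each event to the next event of the same process) and a
message edge relation `msg` (each send to its matching receive).  Suppose that along
every edge the timestamp of the target is computed by the HLC update rules from the
timestamp of its predecessor(s): the target of a process-order edge is either a
local/send event updating from its process predecessor's timestamp, or a receive
event whose current timestamp is its process predecessor's timestamp; and the target
of a message edge is a receive event whose message timestamp is the sender's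
timestamp.  If `e` happens-before `f` (transitive closure of the edges), then the
HLC timestamp of `e` is lexicographically strictly less than that of `f`. -/
theorem hlc_happensBefore_lt {E : Type} [Fintype E]
    (proc msg : E → E → Prop) (hlc : E → ℕ × ℕ)
    (hproc : ∀ e f, proc e f →
      (∃ pt, hlc f = hlcSend (hlc e) pt) ∨
      (∃ pt m, hlc f = hlcRecv (hlc e) pt m))
    (hmsg : ∀ e f, msg e f → ∃ cur pt, hlc f = hlcRecv cur pt (hlc e))
    (e f : E)
    (hhb : Relation.TransGen (fun a b => proc a b ∨ msg a b) e f) :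
    hlcLt (hlc e) (hlc f) := by
  have step : ∀ a b, (proc a b ∨ msg a b) → hlcLt (hlc a) (hlc b) := by
    rintro a b (h | h)
    · rcases hproc a b h with ⟨pt, h⟩ | ⟨pt, m, h⟩
      · rw [h]; exact hlcLt_send _ _
      · rw [h]; exact hlcLt_recv_cur _ _ _
    · obtain ⟨cur, pt, h⟩ := hmsg a b h
      rw [h]; exact hlcLt_recv_msg _ _ _
  induction hhb with
  | single h => exact step _ _ h
  | tail _ h ih => exact hlcLt_trans' ih (step _ _ h)
end

section
/- Consider a finite set of events with HLC timestamps computed by the HLC update rules along process-order and message edges, where each event e has an associated physical clock reading pt(e), and each process's first event updates from the initial timestamp (0, 0). Then for every event e, the l-component of the HLC timestamp of e equals the maximum of pt(e) and the physical clock readings pt(f) over all events f that happen-before e; in particular, l(e) ≥ pt(e), so the HLC l-component always dominates the local physical clock. -/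
open scoped Classical

theorem hlc_aux_step {E : Type}
    (prev sender : E → Option E) (hlc : E → ℕ × ℕ) (pt : E → ℕ)
    (hr : ∀ f s, sender f = some s →
      hlc f = hlcRecv ((prev f).elim (0, 0) hlc) (pt f) (hlc s))
    (hn : ∀ f, sender f = none → hlc f = hlcSend ((prev f).elim (0, 0) hlc) (pt f)) (e : E) :
    pt e ≤ (hlc e).1 ∧
    (∀ a, (prev e = some a ∨ sender e = some a) →
      (hlc a).1 < (hlc e).1 ∨ ((hlc a).1 = (hlc e).1 ∧ (hlc a).2 < (hlc e).2)) ∧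
    ((hlc e).1 ≤ pt e ∨ ∃ a, (prev e = some a ∨ sender e = some a) ∧
      (hlc e).1 = (hlc a).1) := by
  rcases hs : sender e with _ | s <;> [have h := hn e hs; have h := hr e s hs] <;>
    rcases hp : prev e with _ | p <;>
    simp only [hp, Option.elim, hlcSend, hlcRecv] at h <;>
    rw [h] <;> clear h hr hn
  · refine ⟨by split_ifs <;> simp, by simp, Or.inl (by split_ifs <;> simp)⟩
  · simp only [Option.some.injEq, reduceCtorEq, or_false, forall_eq', exists_eq_left']
    split_ifs <;> simp only <;> omega
  · simp only [Option.some.injEq, reduceCtorEq, false_or, forall_eq', exists_eq_left']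
    split_ifs <;> simp only <;> omega
  · have h1 : ∀ P : E → Prop, (∀ a, (some p = some a ∨ some s = some a) → P a) ↔ P p ∧ P s := by
      intro P
      constructor
      · intro h
        exact ⟨h p (Or.inl rfl), h s (Or.inr rfl)⟩
      · rintro ⟨h1, h2⟩ a (h | h) <;> cases h <;> assumption
    have h2 : ∀ P : E → Prop, (∃ a, (some p = some a ∨ some s = some a) ∧ P a) ↔ P p ∨ P s := by
      intro P
      constructor
      · rintro ⟨a, h | h, hP⟩ <;> cases h <;> tauto
      · rintro (h | h)
        · exact ⟨p, Or.inl rfl, h⟩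
        · exact ⟨s, Or.inr rfl, h⟩
    rw [h1, h2]
    split_ifs <;> simp only <;> omega

/-- Consider a finite set `E` of events, where `prev f` is the process predecessor of
`f` (if any; a process's first event has none and updates from the initial timestamp
`(0, 0)`), `sender f` is the sender of the message received at `f` (if `f` is a
receive event), `pt e` is the physical clock reading at `e`, and HLC timestamps are
computed by the HLC update rules: a receive event applies the receive-update to its
process predecessor's timestamp (or `(0,0)`) with the sender's timestamp as message
timestamp, and any other event applies the send/local-event update.  Then the
`l`-component of the HLC timestamp of any event `e` equals the maximum of `pt e` and
the physical clock readings of all events that happen-before `e` (transitive closure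
of process-order and message edges); in particular `l(e) ≥ pt(e)`. -/
theorem hlc_l_eq_max_pt {E : Type} [Fintype E]
    (prev sender : E → Option E) (hlc : E → ℕ × ℕ) (pt : E → ℕ)
    (hupd : ∀ f, hlc f =
      match sender f with
      | some s => hlcRecv ((prev f).elim (0, 0) hlc) (pt f) (hlc s)
      | none => hlcSend ((prev f).elim (0, 0) hlc) (pt f))
    (e : E) :
    (hlc e).1 =
      max (pt e)
        ((Finset.univ.filter (fun g =>
          Relation.TransGen (fun a b => prev b = some a ∨ sender b = some a) g e)).sup pt) ∧
    pt e ≤ (hlc e).1 := by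
  have step := hlc_aux_step prev sender hlc pt
    (fun f s h => by rw [hupd f, h]) (fun f h => by rw [hupd f, h])
  refine ⟨le_antisymm ?_ ?_, (step e).1⟩
  · have wf : WellFounded (fun a b : E => Prod.Lex (· < ·) (· < ·) (hlc a) (hlc b)) :=
      InvImage.wf hlc (WellFounded.prod_lex wellFounded_lt wellFounded_lt)
    have key : ∀ e, ∃ f, (f = e ∨
        Relation.TransGen (fun a b => prev b = some a ∨ sender b = some a) f e) ∧
        (hlc e).1 ≤ pt f := by
      intro e
      induction e using wf.induction with
      | _ e ih =>
        obtain ⟨-, hlt, h | ⟨a, ha, hl⟩⟩ := step e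
        · exact ⟨e, Or.inl rfl, h⟩
        · obtain ⟨f, hf, hle⟩ := ih a (Prod.lex_def.mpr (hlt a ha))
          refine ⟨f, Or.inr ?_, hl ▸ hle⟩
          rcases hf with rfl | hf
          · exact Relation.TransGen.single ha
          · exact hf.tail ha
    obtain ⟨f, rfl | hf, hle⟩ := key e
    · exact le_max_of_le_left hle
    · exact le_max_of_le_right (hle.trans (Finset.le_sup (f := pt) (by simpa using hf)))
  · refine max_le (step e).1 (Finset.sup_le ?_)
    intro g hg
    replace hg := (Finset.mem_filter.mp hg).2
    refine (step g).1.trans ?_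
    have mono : ∀ a b, (prev b = some a ∨ sender b = some a) → (hlc a).1 ≤ (hlc b).1 := by
      intro a b hab
      rcases (step b).2.1 a hab with h | h <;> omega
    induction hg with
    | single h => exact mono _ _ h
    | tail _ h ih => exact ih.trans (mono _ _ h)
end
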